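/- Let α be a type with decidable equality, let f : Finset α → ℤ be a support function on itemsets, let p_s be a fixed itemset, let Δ ≥ 0 be an integer, and define f'(X) = f(X) + Δ if X ⊆ p_s and f'(X) = f(X) otherwise (the anti-discrimination pattern sanitization, which increases the support of p_s and all its subsets by Δ). Then: (a) for every itemset p_x with p_s ⊆ p_x, C(f', p_s, p_x) = C(f, p_s, p_x) + Δ, and in particular C(f', p_s, p_x) ≥ C(f, p_s, p_x); (b) for every itemset p_x ⊊ p_s, C(f', p_x, p_s) = C(f, p_x, p_s). Consequently, for any anonymity threshold k, if C(f, I, J) ≥ k for a pair (I, J) of either form (a) or (b), then C(f', I, J) ≥ k, i.e., the sanitization generates no inference channel anchored at p_s. -/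

import Mathlib

/-- The inference-channel value `C(f, I, J) = ∑_{I ⊆ X ⊆ J} (-1)^{|X \ I|} · f(X)`. -/
def channelValue {α : Type*} [DecidableEq α] (f : Finset α → ℤ) (I J : Finset α) : ℤ :=
  ∑ X ∈ Finset.Icc I J, (-1 : ℤ) ^ (X \ I).card * f X

theorem sum_Icc_neg_one_pow_card_sdiff {α : Type*} [DecidableEq α] {I J : Finset α}
    (h : I ⊂ J) : ∑ X ∈ Finset.Icc I J, (-1 : ℤ) ^ (X \ I).card = 0 := by
  rw [Finset.Icc_eq_image_powerset h.subset, Finset.sum_image]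
  · rw [← Finset.sum_powerset_neg_one_pow_card_of_nonempty (Finset.sdiff_nonempty.2 h.2)]
    refine Finset.sum_congr rfl fun Y hY => ?_
    have hd : Disjoint Y I := Finset.disjoint_of_subset_left (Finset.mem_powerset.1 hY)
      Finset.sdiff_disjoint
    rw [Finset.union_sdiff_left, hd.sdiff_eq_left]
  · intro Y hY Z hZ hYZ
    have hdY : Disjoint Y I := Finset.disjoint_of_subset_left
      (Finset.mem_powerset.1 (Finset.mem_coe.1 hY)) Finset.sdiff_disjoint
    have hdZ : Disjoint Z I := Finset.disjoint_of_subset_left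
      (Finset.mem_powerset.1 (Finset.mem_coe.1 hZ)) Finset.sdiff_disjoint
    have h' := congrArg (· \ I) hYZ
    simpa only [Finset.union_sdiff_left, hdY.sdiff_eq_left, hdZ.sdiff_eq_left] using h'

/-- Anti-discrimination pattern sanitization (adding `Δ ≥ 0` to the support of `p_s`
and of all its subsets) generates no inference channel anchored at `p_s`:
(a) channels between `p_s` and a superset increase by exactly `Δ`;
(b) channels between a strict subset of `p_s` and `p_s` are unchanged;
hence any channel value that was at least `k` stays at least `k`. -/
theorem sanitization_no_inference_channels {α : Type*} [DecidableEq α]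
    (f : Finset α → ℤ) (ps : Finset α) (Δ : ℤ) (hΔ : 0 ≤ Δ)
    (f' : Finset α → ℤ) (hf' : ∀ X, f' X = if X ⊆ ps then f X + Δ else f X) :
    (∀ px, ps ⊆ px →
        channelValue f' ps px = channelValue f ps px + Δ ∧
        channelValue f ps px ≤ channelValue f' ps px) ∧
    (∀ px, px ⊂ ps → channelValue f' px ps = channelValue f px ps) ∧
    (∀ k : ℤ,
      (∀ px, ps ⊆ px → k ≤ channelValue f ps px → k ≤ channelValue f' ps px) ∧
      (∀ px, px ⊂ ps → k ≤ channelValue f px ps → k ≤ channelValue f' px ps)) := by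
  have ha : ∀ px, ps ⊆ px → channelValue f' ps px = channelValue f ps px + Δ := by
    intro px hpx
    have hmem : ps ∈ Finset.Icc ps px := Finset.mem_Icc.2 ⟨le_rfl, hpx⟩
    unfold channelValue
    rw [← Finset.add_sum_erase _ _ hmem, ← Finset.add_sum_erase _ _ hmem]
    have hrest : ∀ X ∈ (Finset.Icc ps px).erase ps,
        (-1 : ℤ) ^ (X \ ps).card * f' X = (-1 : ℤ) ^ (X \ ps).card * f X := by
      intro X hX
      obtain ⟨hne, hX⟩ := Finset.mem_erase.1 hX
      rw [hf', if_neg fun hs => hne (Finset.Subset.antisymm hs (Finset.mem_Icc.1 hX).1)]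
    rw [Finset.sum_congr rfl hrest, hf', if_pos (Finset.Subset.refl ps)]
    simp only [Finset.sdiff_self, Finset.card_empty, pow_zero, one_mul]
    ring
  have hb : ∀ px, px ⊂ ps → channelValue f' px ps = channelValue f px ps := by
    intro px hpx
    have hterm : ∀ X ∈ Finset.Icc px ps, (-1 : ℤ) ^ (X \ px).card * f' X =
        (-1 : ℤ) ^ (X \ px).card * f X + (-1 : ℤ) ^ (X \ px).card * Δ := by
      intro X hX
      rw [hf', if_pos (Finset.mem_Icc.1 hX).2, mul_add]
    unfold channelValue
    rw [Finset.sum_congr rfl hterm, Finset.sum_add_distrib, ← Finset.sum_mul,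
      sum_Icc_neg_one_pow_card_sdiff hpx, zero_mul, add_zero]
  have hle : ∀ px, ps ⊆ px → channelValue f ps px ≤ channelValue f' ps px := fun px hpx => by
    rw [ha px hpx]
    exact le_add_of_nonneg_right hΔ
  exact ⟨fun px hpx => ⟨ha px hpx, hle px hpx⟩, hb, fun k =>
    ⟨fun px hpx hk => hk.trans (hle px hpx), fun px hpx hk => (hb px hpx).symm ▸ hk⟩⟩
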